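/- arXiv:1811.07277 — 9 statements merged into one kernel-verified Lean document; each statement's English description precedes it below -/
import Mathlib

section
/- Let f : [m,M] → ℝ be a continuous convex function, let A₁,…,Aₙ be selfadjoint bounded linear operators on a complex Hilbert space H whose spectra are contained in [m,M], and let Φ₁,…,Φₙ be positive linear maps from the bounded operators on H to the bounded operators on a complex Hilbert space K such that ∑_{i=1}^n Φᵢ(1_H) = 1_K. Then for every unit vector x ∈ K, f(⟨(∑_{i=1}^n Φᵢ(Aᵢ)) x, x⟩) ≤ ⟨(∑_{i=1}^n Φᵢ(f(Aᵢ))) x, x⟩, where f(Aᵢ) is defined by the continuous functional calculus. -/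
open scoped InnerProductSpace

/-- If an affine function is below `f` on the spectrum of a selfadjoint element, the same holds for
the continuous functional calculus. -/
lemma smul_add_smul_one_le_cfc {H : Type*}
    [NormedAddCommGroup H] [InnerProductSpace ℂ H] [CompleteSpace H]
    {f : ℝ → ℝ} {c d : ℝ} {a : H →L[ℂ] H} (ha : IsSelfAdjoint a)
    (hf : ContinuousOn f (spectrum ℝ a)) (h : ∀ y ∈ spectrum ℝ a, c * y + d ≤ f y) :
    c • a + d • (1 : H →L[ℂ] H) ≤ cfc f a := by
  have haff : cfc (fun y : ℝ ↦ c * y + d) a = c • a + d • (1 : H →L[ℂ] H) := by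
    rw [cfc_add_const d (fun y : ℝ ↦ c * y) a, cfc_const_mul_id c a,
      Algebra.algebraMap_eq_smul_one]
  rw [← haff]
  exact cfc_mono h

/-- The state `∑ i, ⟪Φ i (·) x, x⟫` of a unital family of positive maps preserves affine lower
bounds. -/
lemma affine_le_re_inner_sum_cfc {ι H K : Type*} [Fintype ι]
    [NormedAddCommGroup H] [InnerProductSpace ℂ H] [CompleteSpace H]
    [NormedAddCommGroup K] [InnerProductSpace ℂ K] [CompleteSpace K]
    {f : ℝ → ℝ} {c d : ℝ} {A : ι → H →L[ℂ] H} (hA : ∀ i, IsSelfAdjoint (A i))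
    (hf : ∀ i, ContinuousOn f (spectrum ℝ (A i)))
    (h : ∀ i, ∀ y ∈ spectrum ℝ (A i), c * y + d ≤ f y)
    {Φ : ι → (H →L[ℂ] H) →ₗ[ℂ] (K →L[ℂ] K)}
    (hΦpos : ∀ i, ∀ T : H →L[ℂ] H, 0 ≤ T → 0 ≤ Φ i T)
    (hunital : ∑ i, Φ i 1 = 1) {x : K} (hx : ‖x‖ = 1) :
    c * (⟪(∑ i, Φ i (A i)) x, x⟫_ℂ).re + d ≤ (⟪(∑ i, Φ i (cfc f (A i))) x, x⟫_ℂ).re := by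
  have hpos : 0 ≤ ∑ i, Φ i (cfc f (A i) - (c • A i + d • (1 : H →L[ℂ] H))) :=
    Finset.sum_nonneg fun i _ ↦
      hΦpos i _ (sub_nonneg.2 (smul_add_smul_one_le_cfc (hA i) (hf i) (h i)))
  have hsum : ∑ i, Φ i (cfc f (A i) - (c • A i + d • (1 : H →L[ℂ] H))) =
      ∑ i, Φ i (cfc f (A i)) - ((c : ℂ) • ∑ i, Φ i (A i) + (d : ℂ) • 1) := by
    simp_rw [← hunital, ← Complex.coe_smul, map_sub, map_add, map_smul, Finset.smul_sum,
      Finset.sum_sub_distrib, Finset.sum_add_distrib]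
  rw [hsum, ContinuousLinearMap.nonneg_iff_isPositive] at hpos
  have hre := hpos.re_inner_nonneg_left x
  have hxx : ((‖x‖ : ℂ) ^ 2).re = 1 := by simp [hx]
  simpa [-Complex.coe_smul, inner_sub_left, inner_add_left, inner_smul_left, hxx, sum_inner]
    using hre

theorem stmt0 {H K : Type*}
    [NormedAddCommGroup H] [InnerProductSpace ℂ H] [CompleteSpace H]
    [NormedAddCommGroup K] [InnerProductSpace ℂ K] [CompleteSpace K]
    (m M : ℝ) (hmM : m < M) (f : ℝ → ℝ)
    (hconv : ConvexOn ℝ (Set.Icc m M) f) (hcont : ContinuousOn f (Set.Icc m M))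
    (n : ℕ) (A : Fin n → H →L[ℂ] H)
    (hA : ∀ i, IsSelfAdjoint (A i))
    (hspec : ∀ i, spectrum ℝ (A i) ⊆ Set.Icc m M)
    (Φ : Fin n → (H →L[ℂ] H) →ₗ[ℂ] (K →L[ℂ] K))
    (hΦpos : ∀ i, ∀ T : H →L[ℂ] H, 0 ≤ T → 0 ≤ Φ i T)
    (hunital : ∑ i, Φ i 1 = 1)
    (x : K) (hx : ‖x‖ = 1) :
    f ((⟪(∑ i, Φ i (A i)) x, x⟫_ℂ).re) ≤ (⟪(∑ i, Φ i (cfc f (A i))) x, x⟫_ℂ).re := by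
  have hle {g : ℝ → ℝ} {c d : ℝ} (hg : ContinuousOn g (Set.Icc m M))
      (h : ∀ y ∈ Set.Icc m M, c * y + d ≤ g y) :=
    affine_le_re_inner_sum_cfc hA (fun i ↦ hg.mono (hspec i)) (fun i y hy ↦ h y (hspec i hy))
      hΦpos hunital hx
  have hmem : (⟪(∑ i, Φ i (A i)) x, x⟫_ℂ).re ∈ Set.Icc m M := by
    constructor
    · have := hle (g := fun y ↦ y) (c := 0) (d := m) continuousOn_id (by simp +contextual)
      simpa [cfc_id' ℝ (A _) (hA _)] using this
    · have := hle (g := fun _ ↦ 0) (c := 1) (d := -M) continuousOn_const (by simp +contextual)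
      simpa using this
  refine le_of_forall_lt fun a ha ↦ ?_
  obtain ⟨b, hab, hb⟩ := exists_between ha
  obtain ⟨c, d, hcd, hval⟩ :=
    hconv.exists_affine_le_of_lt_real hmem hb isClosed_Icc hcont.lowerSemicontinuousOn
  exact hab.trans_le (hval ▸ hle hcont hcd)
end

section
/- Let f : [m,M] → ℝ be a continuous convex function, let A₁,…,Aₙ and B₁,…,Bₙ be selfadjoint bounded linear operators on a complex Hilbert space H with spectra contained in [m,M], and let Φ₁,…,Φₙ be positive linear maps from the bounded operators on H to the bounded operators on a complex Hilbert space K with ∑_{i=1}^n Φᵢ(1_H) = 1_K. Suppose ∑_{i=1}^n Φᵢ(Aᵢ) = ∑_{i=1}^n Φᵢ(Bᵢ). Then for any α ≥ 0 and any real β such that a_f t + b_f − α f(t) ≤ β for all t ∈ [m,M], one has ∑_{i=1}^n Φᵢ(f(Aᵢ)) ≤ β·1_K + α ∑_{i=1}^n Φᵢ(f(Bᵢ)) in the Loewner order. -/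
theorem ConvexOn.le_chord {f : ℝ → ℝ} {m M : ℝ} (hmM : m < M)
    (hf : ConvexOn ℝ (Set.Icc m M) f) {t : ℝ} (ht : t ∈ Set.Icc m M) :
    f t ≤ ((f M - f m) / (M - m)) * t + (M * f m - m * f M) / (M - m) := by
  have hd : 0 < M - m := sub_pos.2 hmM
  have key := hf.2 (Set.left_mem_Icc.2 hmM.le) (Set.right_mem_Icc.2 hmM.le)
    (div_nonneg (sub_nonneg.2 ht.2) hd.le) (div_nonneg (sub_nonneg.2 ht.1) hd.le)
    (by field_simp; ring)
  simp only [smul_eq_mul] at key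
  have hpt : (M - t) / (M - m) * m + (t - m) / (M - m) * M = t := by
    field_simp
    ring
  rw [hpt] at key
  refine key.trans_eq ?_
  field_simp
  ring

theorem sum_map_smul_add_smul {ι E F : Type*} [Fintype ι]
    [AddCommGroup E] [Module ℂ E] [AddCommGroup F] [Module ℂ F]
    (Φ : ι → E →ₗ[ℂ] F) (S T : ι → E) (a b : ℝ) :
    ∑ i, Φ i (a • S i + b • T i) = a • ∑ i, Φ i (S i) + b • ∑ i, Φ i (T i) := by
  simp only [map_add, LinearMap.map_smul_of_tower, Finset.sum_add_distrib, Finset.smul_sum]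

section

variable {H K : Type*}
  [NormedAddCommGroup H] [InnerProductSpace ℂ H] [CompleteSpace H]
  [NormedAddCommGroup K] [InnerProductSpace ℂ K] [CompleteSpace K]

theorem cfc_mul_id_add_const (A : H →L[ℂ] H) (hA : IsSelfAdjoint A) (a b : ℝ) :
    cfc (fun t : ℝ => a * t + b) A = a • A + b • (1 : H →L[ℂ] H) := by
  rw [cfc_add_const b (fun t : ℝ => a * t) A, cfc_const_mul_id a A, Algebra.algebraMap_eq_smul_one]

theorem sum_map_le_sum_map_of_nonneg {ι : Type*} [Fintype ι]
    {Φ : ι → (H →L[ℂ] H) →ₗ[ℂ] (K →L[ℂ] K)}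
    (hΦ : ∀ i, ∀ T : H →L[ℂ] H, 0 ≤ T → 0 ≤ Φ i T) {S T : ι → H →L[ℂ] H}
    (h : ∀ i, S i ≤ T i) : ∑ i, Φ i (S i) ≤ ∑ i, Φ i (T i) := by
  refine Finset.sum_le_sum fun i _ => ?_
  rw [← sub_nonneg, ← map_sub]
  exact hΦ i _ (sub_nonneg.2 (h i))

end

theorem stmt1 {H K : Type*}
    [NormedAddCommGroup H] [InnerProductSpace ℂ H] [CompleteSpace H]
    [NormedAddCommGroup K] [InnerProductSpace ℂ K] [CompleteSpace K]
    (m M : ℝ) (hmM : m < M) (f : ℝ → ℝ)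
    (hconv : ConvexOn ℝ (Set.Icc m M) f) (hcont : ContinuousOn f (Set.Icc m M))
    (n : ℕ) (A B : Fin n → H →L[ℂ] H)
    (hA : ∀ i, IsSelfAdjoint (A i)) (hB : ∀ i, IsSelfAdjoint (B i))
    (hspecA : ∀ i, spectrum ℝ (A i) ⊆ Set.Icc m M)
    (hspecB : ∀ i, spectrum ℝ (B i) ⊆ Set.Icc m M)
    (Φ : Fin n → (H →L[ℂ] H) →ₗ[ℂ] (K →L[ℂ] K))
    (hΦpos : ∀ i, ∀ T : H →L[ℂ] H, 0 ≤ T → 0 ≤ Φ i T)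
    (hunital : ∑ i, Φ i 1 = 1)
    (heq : ∑ i, Φ i (A i) = ∑ i, Φ i (B i))
    (α : ℝ) (hα : 0 ≤ α) (β : ℝ)
    (hβ : ∀ t ∈ Set.Icc m M,
      ((f M - f m) / (M - m)) * t + (M * f m - m * f M) / (M - m) - α * f t ≤ β) :
    ∑ i, Φ i (cfc f (A i)) ≤ β • (1 : K →L[ℂ] K) + α • ∑ i, Φ i (cfc f (B i)) := by
  set a := (f M - f m) / (M - m)
  set b := (M * f m - m * f M) / (M - m)
  have hupper : ∀ i, cfc f (A i) ≤ a • A i + b • (1 : H →L[ℂ] H) := fun i => by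
    rw [← cfc_mul_id_add_const (A i) (hA i)]
    exact cfc_mono (fun t ht => hconv.le_chord hmM (hspecA i ht)) (hcont.mono (hspecA i))
  have hlower : ∀ i, a • B i + b • (1 : H →L[ℂ] H) ≤ β • (1 : H →L[ℂ] H) + α • cfc f (B i) :=
    fun i => by
    have hfB : ContinuousOn f (spectrum ℝ (B i)) := hcont.mono (hspecB i)
    rw [← cfc_mul_id_add_const (B i) (hB i), ← cfc_const_mul α f (B i) hfB,
      ← Algebra.algebraMap_eq_smul_one, ← cfc_const_add β (fun t => α * f t) (B i)]
    exact cfc_mono (fun t ht => by linarith [hβ t (hspecB i ht)])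
  calc ∑ i, Φ i (cfc f (A i))
      ≤ ∑ i, Φ i (a • A i + b • (1 : H →L[ℂ] H)) := sum_map_le_sum_map_of_nonneg hΦpos hupper
    _ = ∑ i, Φ i (a • B i + b • (1 : H →L[ℂ] H)) := by
      simp only [sum_map_smul_add_smul, heq]
    _ ≤ ∑ i, Φ i (β • (1 : H →L[ℂ] H) + α • cfc f (B i)) :=
      sum_map_le_sum_map_of_nonneg hΦpos hlower
    _ = β • (1 : K →L[ℂ] K) + α • ∑ i, Φ i (cfc f (B i)) := by
      rw [sum_map_smul_add_smul, hunital]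
end

section
/- Let 0 < ε < 1, and let p₁,…,pₙ and q₁,…,qₙ be probability distributions (pᵢ, qᵢ > 0, ∑pᵢ = ∑qᵢ = 1) with pᵢ, qᵢ ∈ [ε,1] for all i. If ∑_{i=1}^n pᵢ² ≤ ∑_{i=1}^n pᵢ qᵢ, then −((ε − 1)/log ε) · ∑_{i=1}^n pᵢ log qᵢ ≤ −∑_{i=1}^n pᵢ log pᵢ. -/
/-- Concavity of the logarithm: on `[ε, 1]` the rescaled logarithm lies above `x - 1`, its chord. -/
theorem sub_one_le_mul_log_of_mem_Icc {ε x : ℝ} (hε0 : 0 < ε) (hε1 : ε < 1)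
    (hx : x ∈ Set.Icc ε 1) : x - 1 ≤ (ε - 1) / Real.log ε * Real.log x := by
  have hlog : Real.log ε < 0 := Real.log_neg hε0 hε1
  have hε : 0 < 1 - ε := by linarith
  have hchord : (1 - x) / (1 - ε) * Real.log ε ≤ Real.log x := by
    have h := strictConcaveOn_log_Ioi.concaveOn.2 (Set.mem_Ioi.2 hε0)
      (Set.mem_Ioi.2 (zero_lt_one' ℝ))
      (div_nonneg (sub_nonneg.2 hx.2) hε.le) (div_nonneg (sub_nonneg.2 hx.1) hε.le)
      (by rw [← add_div, div_eq_one_iff_eq hε.ne']; ring)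
    simp only [smul_eq_mul, Real.log_one, mul_zero, add_zero, mul_one] at h
    have hcomb : (1 - x) / (1 - ε) * ε + (x - ε) / (1 - ε) = x := by
      field_simp
      ring
    rwa [hcomb] at h
  have hc : 0 ≤ (ε - 1) / Real.log ε := div_nonneg_of_nonpos (by linarith) hlog.le
  calc x - 1 = (ε - 1) / Real.log ε * ((1 - x) / (1 - ε) * Real.log ε) := by
        field_simp [hlog.ne, hε.ne']
        ring
    _ ≤ _ := mul_le_mul_of_nonneg_left hchord hc

theorem stmt7 (ε : ℝ) (hε0 : 0 < ε) (hε1 : ε < 1)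
    (n : ℕ) (p q : Fin n → ℝ)
    (hp : ∀ i, p i ∈ Set.Icc ε 1) (hq : ∀ i, q i ∈ Set.Icc ε 1)
    (hp0 : ∀ i, 0 < p i) (hq0 : ∀ i, 0 < q i)
    (hp1 : ∑ i, p i = 1) (hq1 : ∑ i, q i = 1)
    (hpq : ∑ i, p i ^ 2 ≤ ∑ i, p i * q i) :
    -((ε - 1) / Real.log ε) * ∑ i, p i * Real.log (q i) ≤ -∑ i, p i * Real.log (p i) := by
  have hlower : ∑ i, p i * q i - 1 ≤ (ε - 1) / Real.log ε * ∑ i, p i * Real.log (q i) := by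
    have hsum : ∑ i, p i * q i - 1 = ∑ i, (p i * q i - p i) := by
      rw [Finset.sum_sub_distrib, hp1]
    rw [hsum, Finset.mul_sum]
    refine Finset.sum_le_sum fun i _ => ?_
    have h := mul_le_mul_of_nonneg_left (sub_one_le_mul_log_of_mem_Icc hε0 hε1 (hq i)) (hp0 i).le
    linarith
  have hupper : ∑ i, p i * Real.log (p i) ≤ ∑ i, p i ^ 2 - 1 := by
    rw [← hp1, ← Finset.sum_sub_distrib]
    refine Finset.sum_le_sum fun i _ => ?_
    have h := mul_le_mul_of_nonneg_left (Real.log_le_sub_one_of_pos (hp0 i)) (hp0 i).le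
    linarith
  linarith
end

section
/- Let 0 < ε < 1, and let p₁,…,pₙ and q₁,…,qₙ be probability distributions (pᵢ, qᵢ > 0, ∑pᵢ = ∑qᵢ = 1) with pᵢ, qᵢ ∈ [ε,1] for all i. If ∑_{i=1}^n pᵢ² ≤ ∑_{i=1}^n pᵢ qᵢ, then −∑_{i=1}^n pᵢ log qᵢ − log S(ε) ≤ −∑_{i=1}^n pᵢ log pᵢ, where log S(ε) = (log ε)/(ε − 1) − 1 − log((log ε)/(ε − 1)). -/
/-- On `[ε, 1]` the logarithm lies above its chord. -/
theorem chord_le_log {ε x : ℝ} (hε0 : 0 < ε) (hε1 : ε < 1) (hx : x ∈ Set.Icc ε 1) :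
    Real.log ε / (ε - 1) * (x - 1) ≤ Real.log x := by
  have h1 : 0 < 1 - ε := sub_pos.2 hε1
  have h2 : ε - 1 ≠ 0 := by linarith
  have h := strictConcaveOn_log_Ioi.concaveOn.2 (Set.mem_Ioi.2 hε0) (Set.mem_Ioi.2 one_pos)
    (div_nonneg (sub_nonneg.2 hx.2) h1.le) (div_nonneg (sub_nonneg.2 hx.1) h1.le)
    (by field_simp; ring)
  simp only [smul_eq_mul, Real.log_one, mul_zero, add_zero, mul_one] at h
  have e1 : (1 - x) / (1 - ε) * ε + (x - ε) / (1 - ε) = x := by field_simp; ring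
  have e2 : Real.log ε / (ε - 1) * (x - 1) = (1 - x) / (1 - ε) * Real.log ε := by
    rw [← neg_sub 1 ε, ← neg_sub 1 x]
    field_simp
  rwa [e1, ← e2] at h

/-- The tangent line bound for the logarithm at `k⁻¹`. -/
theorem log_le_mul_sub_one_sub_log {k x : ℝ} (hk : 0 < k) (hx : 0 < x) :
    Real.log x ≤ k * x - 1 - Real.log k := by
  have h := Real.log_le_sub_one_of_pos (mul_pos hk hx)
  rw [Real.log_mul hk.ne' hx.ne'] at h
  linarith

theorem stmt8 (ε : ℝ) (hε0 : 0 < ε) (hε1 : ε < 1)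
    (n : ℕ) (p q : Fin n → ℝ)
    (hp : ∀ i, p i ∈ Set.Icc ε 1) (hq : ∀ i, q i ∈ Set.Icc ε 1)
    (hp0 : ∀ i, 0 < p i) (hq0 : ∀ i, 0 < q i)
    (hp1 : ∑ i, p i = 1) (hq1 : ∑ i, q i = 1)
    (hpq : ∑ i, p i ^ 2 ≤ ∑ i, p i * q i) :
    (-∑ i, p i * Real.log (q i)) -
        (Real.log ε / (ε - 1) - 1 - Real.log (Real.log ε / (ε - 1))) ≤
      -∑ i, p i * Real.log (p i) := by
  have hk : 0 < Real.log ε / (ε - 1) :=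
    div_pos_of_neg_of_neg (Real.log_neg hε0 hε1) (sub_neg.2 hε1)
  have hchord : ∀ i, Real.log ε / (ε - 1) * (q i - 1) ≤ Real.log (q i) :=
    fun i => chord_le_log hε0 hε1 (hq i)
  generalize Real.log ε / (ε - 1) = k at *
  have hlogq : k * ∑ i, p i * q i - k * ∑ i, p i ≤ ∑ i, p i * Real.log (q i) := by
    rw [Finset.mul_sum, Finset.mul_sum, ← Finset.sum_sub_distrib]
    refine Finset.sum_le_sum fun i _ => ?_
    linarith [mul_le_mul_of_nonneg_left (hchord i) (hp0 i).le]
  have hlogp : ∑ i, p i * Real.log (p i) ≤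
      k * ∑ i, p i ^ 2 - (1 + Real.log k) * ∑ i, p i := by
    rw [Finset.mul_sum, Finset.mul_sum, ← Finset.sum_sub_distrib]
    refine Finset.sum_le_sum fun i _ => ?_
    linarith [mul_le_mul_of_nonneg_left (log_le_mul_sub_one_sub_log hk (hp0 i)) (hp0 i).le]
  rw [hp1] at hlogq hlogp
  linarith [mul_le_mul_of_nonneg_left hpq hk.le]
end

section
/- Let 0 < ε < 1, and let p₁,…,pₙ and q₁,…,qₙ be probability distributions (pᵢ, qᵢ > 0, ∑pᵢ = ∑qᵢ = 1) with pᵢ, qᵢ ∈ [ε,1] for all i. If ∑_{i=1}^n pᵢ qᵢ ≤ ∑_{i=1}^n pᵢ², then both −∑_{i=1}^n pᵢ log pᵢ ≤ −((log ε)/(ε − 1)) · ∑_{i=1}^n pᵢ log qᵢ and −∑_{i=1}^n pᵢ log pᵢ ≤ log S(ε) − ∑_{i=1}^n pᵢ log qᵢ hold, where log S(ε) = (log ε)/(ε − 1) − 1 − log((log ε)/(ε − 1)). -/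
/-- On `[ε, 1]` the chord of `Real.log` through `ε` and `1` lies below its graph. -/
theorem neg_log_le_chord {ε x : ℝ} (hε0 : 0 < ε) (hε1 : ε < 1) (hx : x ∈ Set.Icc ε 1) :
    -Real.log x ≤ Real.log ε / (ε - 1) * (1 - x) := by
  have hne : 1 - ε ≠ 0 := by linarith
  have hne' : ε - 1 ≠ 0 := by linarith
  have h := strictConcaveOn_log_Ioi.concaveOn.2 (Set.mem_Ioi.2 hε0) (Set.mem_Ioi.2 one_pos)
    (div_nonneg (sub_nonneg.2 hx.2) (sub_pos.2 hε1).le)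
    (div_nonneg (sub_nonneg.2 hx.1) (sub_pos.2 hε1).le)
    (by field_simp; ring)
  simp only [smul_eq_mul, Real.log_one, mul_zero, add_zero, mul_one] at h
  have hcomb : (1 - x) / (1 - ε) * ε + (x - ε) / (1 - ε) = x := by field_simp; ring
  have hcoef : Real.log ε / (ε - 1) * (1 - x) = -((1 - x) / (1 - ε) * Real.log ε) := by
    rw [← neg_sub 1 ε, div_neg]
    ring
  rw [hcomb] at h
  linarith

theorem stmt9 (ε : ℝ) (hε0 : 0 < ε) (hε1 : ε < 1)
    (n : ℕ) (p q : Fin n → ℝ)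
    (hp : ∀ i, p i ∈ Set.Icc ε 1) (hq : ∀ i, q i ∈ Set.Icc ε 1)
    (hp0 : ∀ i, 0 < p i) (hq0 : ∀ i, 0 < q i)
    (hp1 : ∑ i, p i = 1) (hq1 : ∑ i, q i = 1)
    (hqp : ∑ i, p i * q i ≤ ∑ i, p i ^ 2) :
    (-∑ i, p i * Real.log (p i) ≤ -(Real.log ε / (ε - 1)) * ∑ i, p i * Real.log (q i)) ∧
      (-∑ i, p i * Real.log (p i) ≤
        (Real.log ε / (ε - 1) - 1 - Real.log (Real.log ε / (ε - 1))) -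
          ∑ i, p i * Real.log (q i)) := by
  have hc : 0 < Real.log ε / (ε - 1) :=
    div_pos_of_neg_of_neg (Real.log_neg hε0 hε1) (by linarith)
  have hchord := fun i => neg_log_le_chord hε0 hε1 (hp i)
  generalize Real.log ε / (ε - 1) = c at hc hchord ⊢
  have hentropy : -∑ i, p i * Real.log (p i) ≤ c * (1 - ∑ i, p i * q i) := by
    calc -∑ i, p i * Real.log (p i) = ∑ i, p i * -Real.log (p i) := by simp
      _ ≤ ∑ i, p i * (c * (1 - p i)) :=
        Finset.sum_le_sum fun i _ => mul_le_mul_of_nonneg_left (hchord i) (hp0 i).le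
      _ = c * (∑ i, p i - ∑ i, p i ^ 2) := by
        rw [← Finset.sum_sub_distrib, Finset.mul_sum]
        exact Finset.sum_congr rfl fun i _ => by ring
      _ ≤ c * (1 - ∑ i, p i * q i) := by
        rw [hp1]
        gcongr
  have hcross : ∑ i, p i * Real.log (q i) ≤ ∑ i, p i * q i - 1 := by
    rw [← hp1, ← Finset.sum_sub_distrib]
    refine Finset.sum_le_sum fun i _ => ?_
    nlinarith [mul_le_mul_of_nonneg_left (Real.log_le_sub_one_of_pos (hq0 i)) (hp0 i).le]
  have hscaled : ∑ i, p i * Real.log (q i) ≤ c * ∑ i, p i * q i - (1 + Real.log c) * ∑ i, p i := by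
    rw [Finset.mul_sum, Finset.mul_sum, ← Finset.sum_sub_distrib]
    refine Finset.sum_le_sum fun i _ => ?_
    have h := Real.log_le_sub_one_of_pos (mul_pos hc (hq0 i))
    rw [Real.log_mul hc.ne' (hq0 i).ne'] at h
    nlinarith [mul_le_mul_of_nonneg_left h (hp0 i).le]
  constructor
  · nlinarith [mul_le_mul_of_nonneg_left hcross hc.le]
  · rw [hp1] at hscaled
    linarith
end

section
/- Let 0 < r ≤ 1 and let A and B be n×n complex Hermitian positive definite matrices with trace 1. Then |H_r(A) − H_r(B)| ≤ (1 − r)^{(1−r)/r}·n, where H_r(X) = (∑_{i=1}^n λᵢ(X)^{1−r} − 1)/r is the quantum Tsallis entropy computed from the eigenvalues λᵢ(X) of X. -/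
open scoped ComplexOrder

theorem rpow_one_sub_sub_self_le {r x : ℝ} (hr0 : 0 < r) (hr1 : r ≤ 1) (hx : 0 ≤ x) :
    (x ^ (1 - r) - x) / r ≤ (1 - r) ^ ((1 - r) / r) := by
  rw [div_le_iff₀ hr0]
  rcases hr1.eq_or_lt with rfl | hr
  · simpa using hx
  · have hs : 0 < 1 - r := sub_pos.2 hr
    have amgm := Real.geom_mean_le_arith_mean2_weighted hs.le hr0.le hx
      (Real.rpow_nonneg hs.le (1 / r)) (by ring)
    have hc : (1 - r) ^ (1 / r) = (1 - r) * (1 - r) ^ ((1 - r) / r) := by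
      have he : 1 / r = 1 + (1 - r) / r := by field_simp; ring
      rw [he, Real.rpow_add hs, Real.rpow_one]
    rw [← Real.rpow_mul hs.le, one_div_mul_cancel hr0.ne', Real.rpow_one, hc] at amgm
    refine le_of_mul_le_mul_left ?_ hs
    linarith

theorem tsallis_sum_mem_Icc {ι : Type*} [Fintype ι] {r : ℝ} (hr0 : 0 < r) (hr1 : r ≤ 1)
    {p : ι → ℝ} (hp : ∀ i, 0 < p i) (hsum : ∑ i, p i = 1) :
    ((∑ i, p i ^ (1 - r)) - 1) / r ∈
      Set.Icc 0 ((1 - r) ^ ((1 - r) / r) * (Fintype.card ι : ℝ)) := by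
  have key : ((∑ i, p i ^ (1 - r)) - 1) / r = ∑ i, (p i ^ (1 - r) - p i) / r := by
    rw [← Finset.sum_div, Finset.sum_sub_distrib, hsum]
  rw [key]
  constructor
  · refine Finset.sum_nonneg fun i _ => div_nonneg (sub_nonneg.2 ?_) hr0.le
    have h1 : p i ≤ 1 :=
      hsum ▸ Finset.single_le_sum (fun j _ => (hp j).le) (Finset.mem_univ i)
    exact Real.self_le_rpow_of_le_one (hp i).le h1 (by linarith)
  · refine (Finset.sum_le_sum fun i _ =>
      rpow_one_sub_sub_self_le hr0 hr1 (hp i).le).trans_eq ?_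
    simp [mul_comm]

theorem Matrix.IsHermitian.sum_eigenvalues_eq_one {ι : Type*} [Fintype ι] [DecidableEq ι]
    {A : Matrix ι ι ℂ} (hA : A.IsHermitian) (hT : A.trace = 1) :
    ∑ i, hA.eigenvalues i = 1 := by
  have h := hA.trace_eq_sum_eigenvalues
  rw [hT] at h
  rw [← RCLike.ofReal_sum] at h
  exact Complex.ofReal_injective (by simpa using h.symm)

theorem stmt13 (r : ℝ) (hr0 : 0 < r) (hr1 : r ≤ 1)
    (n : ℕ) (A B : Matrix (Fin n) (Fin n) ℂ)
    (hA : A.PosDef) (hB : B.PosDef)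
    (hTA : A.trace = 1) (hTB : B.trace = 1) :
    |((∑ i, hA.1.eigenvalues i ^ (1 - r)) - 1) / r -
        ((∑ i, hB.1.eigenvalues i ^ (1 - r)) - 1) / r| ≤
      (1 - r) ^ ((1 - r) / r) * n := by
  have h1 := tsallis_sum_mem_Icc hr0 hr1 hA.eigenvalues_pos (hA.1.sum_eigenvalues_eq_one hTA)
  have h2 := tsallis_sum_mem_Icc hr0 hr1 hB.eigenvalues_pos (hB.1.sum_eigenvalues_eq_one hTB)
  rw [Fintype.card_fin] at h1 h2
  exact abs_sub_le_iff.2 ⟨by linarith [h1.2, h2.1], by linarith [h2.2, h1.1]⟩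
end

section
/- Let 0 < m < M, h = M/m, and let A₁,…,Aₙ and B₁,…,Bₙ be positive invertible selfadjoint bounded linear operators on a complex Hilbert space H with spectra contained in [m,M], and let p₁,…,pₙ be positive real numbers with ∑_{i=1}^n pᵢ = 1. Suppose ∑_{i=1}^n pᵢ Aᵢ = ∑_{i=1}^n pᵢ Bᵢ. Then for any real r with r < 0 or r > 1, one has ∑_{i=1}^n pᵢ Aᵢ^r ≤ C(h,r)·1_H + ∑_{i=1}^n pᵢ Bᵢ^r in the Loewner order, where C(h,r) = m^r · { (h − h^r)/(h − 1) + (r − 1)·((h^r − 1)/(r(h − 1)))^{r/(r−1)} }. -/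
/-- Bernoulli's inequality for real exponents outside `[0, 1]`. -/
theorem one_add_mul_sub_one_le_rpow {x r : ℝ} (hx : 0 < x) (hr : r < 0 ∨ 1 < r) :
    1 + r * (x - 1) ≤ x ^ r := by
  rcases hr with hr | hr
  · have hinv : 0 < x⁻¹ := inv_pos.2 hx
    have hb := one_add_mul_self_le_rpow_one_add (s := x⁻¹ - 1) (by linarith)
      (p := 1 - r) (by linarith)
    rw [add_sub_cancel, Real.inv_rpow hx.le, ← Real.rpow_neg hx.le, neg_sub,
      Real.rpow_sub_one hx.ne', le_div_iff₀ hx] at hb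
    refine le_trans (le_of_eq ?_) hb
    field_simp
    ring
  · simpa using one_add_mul_self_le_rpow_one_add (s := x - 1) (by linarith) hr.le

/-- For exponents outside `[0, 1]`, the graph of `t ↦ t ^ r` lies above its tangent at `a`. -/
theorem rpow_add_mul_sub_le_rpow {a t r : ℝ} (ha : 0 < a) (ht : 0 < t) (hr : r < 0 ∨ 1 < r) :
    a ^ r + r * a ^ (r - 1) * (t - a) ≤ t ^ r := by
  have hb := one_add_mul_sub_one_le_rpow (div_pos ht ha) hr
  rw [Real.div_rpow ht.le ha.le, le_div_iff₀ (Real.rpow_pos_of_pos ha r)] at hb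
  refine le_trans (le_of_eq ?_) hb
  rw [Real.rpow_sub_one ha.ne']
  field_simp

/-- For exponents outside `[0, 1]`, the graph of `t ↦ t ^ r` lies below its chord on `[m, M]`. -/
theorem sub_mul_rpow_le {m M t r : ℝ} (hm : 0 < m) (ht : t ∈ Set.Icc m M)
    (hr : r < 0 ∨ 1 < r) :
    (M - m) * t ^ r ≤ (M - t) * m ^ r + (t - m) * M ^ r := by
  have ht0 : 0 < t := hm.trans_le ht.1
  have h1 := mul_le_mul_of_nonneg_left (rpow_add_mul_sub_le_rpow ht0 hm hr) (sub_nonneg.2 ht.2)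
  have h2 := mul_le_mul_of_nonneg_left
    (rpow_add_mul_sub_le_rpow ht0 (ht0.trans_le ht.2) hr) (sub_nonneg.2 ht.1)
  linarith

theorem rpow_sub_one_div_pos {h r : ℝ} (hh : 1 < h) (hr : r < 0 ∨ 1 < r) :
    0 < (h ^ r - 1) / (r * (h - 1)) := by
  rcases hr with hr | hr
  · exact div_pos_of_neg_of_neg (sub_neg.2 (Real.rpow_lt_one_of_one_lt_of_neg hh hr))
      (mul_neg_of_neg_of_pos hr (sub_pos.2 hh))
  · exact div_pos (sub_pos.2 (Real.one_lt_rpow hh (by linarith)))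
      (mul_pos (by linarith) (sub_pos.2 hh))

/-- An affine function squeezed between `t ↦ t ^ r` and its upward translate by `C(h, r)`. -/
theorem exists_affine_rpow_bounds {m M h r : ℝ} (hm : 0 < m) (hmM : m < M) (hh : h = M / m)
    (hr : r < 0 ∨ 1 < r) :
    ∃ a b : ℝ, ∀ t ∈ Set.Icc m M, t ^ r ≤ a * t + b ∧
      a * t + b ≤ t ^ r + m ^ r * ((h - h ^ r) / (h - 1) +
          (r - 1) * ((h ^ r - 1) / (r * (h - 1))) ^ (r / (r - 1))) := by
  have hh1 : 1 < h := by rw [hh, one_lt_div hm]; exact hmM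
  have hM : M = h * m := by rw [hh]; field_simp
  have hr0 : r ≠ 0 := by rintro rfl; norm_num at hr
  have hr1 : r - 1 ≠ 0 := by intro H; rcases hr with hr | hr <;> linarith
  have hh1' : h - 1 ≠ 0 := (sub_pos.2 hh1).ne'
  set k := (h ^ r - 1) / (r * (h - 1)) with hk
  have hk0 : 0 < k := rpow_sub_one_div_pos hh1 hr
  have hkr : h ^ r = 1 + k * (r * (h - 1)) := by rw [hk]; field_simp; ring
  have hc0 : 0 < k ^ (1 / (r - 1)) := Real.rpow_pos_of_pos hk0 _
  have hmr : m ^ r = m ^ (r - 1) * m := by rw [Real.rpow_sub_one hm.ne']; field_simp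
  have hb : (h - h ^ r) / (h - 1) = 1 - r * k := by
    rw [hkr]; field_simp; ring
  refine ⟨r * k * m ^ (r - 1), m ^ r * (1 - r * k), fun t ht => ⟨?_, ?_⟩⟩
  · have hchord := sub_mul_rpow_le hm ht hr
    rw [hM, Real.mul_rpow (by linarith) hm.le, hkr, hmr] at hchord
    refine le_of_mul_le_mul_left (hchord.trans (le_of_eq ?_))
      (mul_pos (sub_pos.2 hh1) hm |>.trans_eq (by ring : (h - 1) * m = h * m - m))
    rw [hmr]
    ring
  · have htan := rpow_add_mul_sub_le_rpow (mul_pos hm hc0) (hm.trans_le ht.1) hr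
    have e1 : (m * k ^ (1 / (r - 1))) ^ r = m ^ r * k ^ (r / (r - 1)) := by
      rw [Real.mul_rpow hm.le hc0.le, ← Real.rpow_mul hk0.le, one_div_mul_eq_div]
    have e2 : (m * k ^ (1 / (r - 1))) ^ (r - 1) = m ^ (r - 1) * k := by
      rw [Real.mul_rpow hm.le hc0.le, ← Real.rpow_mul hk0.le, one_div_mul_cancel hr1,
        Real.rpow_one]
    have e3 : k ^ (r / (r - 1)) = k * k ^ (1 / (r - 1)) := by
      rw [← Real.rpow_one_add' hk0.le (by field_simp; simpa using ⟨hr0, hr1⟩)]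
      congr 1
      field_simp
      ring
    rw [e1, e2, e3, hmr] at htan
    rw [hb, e3, hmr]
    linarith

/-- If an affine function lies between `f` and `f + C` on a set containing all the spectra, then
the weighted sums of `f (A i)` and `f (B i)` differ by at most `C`. -/
theorem sum_smul_cfc_le_of_affine_bounds {ι 𝓐 : Type*} [CStarAlgebra 𝓐] [PartialOrder 𝓐]
    [StarOrderedRing 𝓐] (s : Finset ι) {A B : ι → 𝓐} {p : ι → ℝ} {S : Set ℝ} {f : ℝ → ℝ}
    {a b C : ℝ} (hA : ∀ i ∈ s, IsSelfAdjoint (A i)) (hB : ∀ i ∈ s, IsSelfAdjoint (B i))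
    (hspecA : ∀ i ∈ s, spectrum ℝ (A i) ⊆ S) (hspecB : ∀ i ∈ s, spectrum ℝ (B i) ⊆ S)
    (hp : ∀ i ∈ s, 0 ≤ p i) (hp1 : ∑ i ∈ s, p i = 1)
    (heq : ∑ i ∈ s, p i • A i = ∑ i ∈ s, p i • B i)
    (hf : ContinuousOn f S) (hlow : ∀ t ∈ S, f t ≤ a * t + b)
    (hupp : ∀ t ∈ S, a * t + b ≤ f t + C) :
    ∑ i ∈ s, p i • cfc f (A i) ≤ C • (1 : 𝓐) + ∑ i ∈ s, p i • cfc f (B i) := by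
  have haff : ∀ T : 𝓐, IsSelfAdjoint T →
      cfc (fun t : ℝ => a * t + b) T = a • T + b • (1 : 𝓐) := fun T hT => by
    rw [cfc_add_const b (fun t => a * t) T, cfc_const_mul_id a T, Algebra.algebraMap_eq_smul_one]
  calc ∑ i ∈ s, p i • cfc f (A i)
      ≤ ∑ i ∈ s, p i • (a • A i + b • (1 : 𝓐)) := by
        refine Finset.sum_le_sum fun i hi => smul_le_smul_of_nonneg_left ?_ (hp i hi)
        rw [← haff _ (hA i hi)]
        exact cfc_mono (fun t ht => hlow t (hspecA i hi ht)) (hf.mono (hspecA i hi))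
    _ = ∑ i ∈ s, p i • (a • B i + b • (1 : 𝓐)) := by
        simp only [smul_add, Finset.sum_add_distrib, smul_comm _ a, ← Finset.smul_sum, heq]
    _ ≤ ∑ i ∈ s, p i • (cfc f (B i) + C • (1 : 𝓐)) := by
        refine Finset.sum_le_sum fun i hi => smul_le_smul_of_nonneg_left ?_ (hp i hi)
        have hfB := hf.mono (hspecB i hi)
        rw [← haff _ (hB i hi), ← Algebra.algebraMap_eq_smul_one,
          ← cfc_add_const C f (B i) hfB (hB i hi)]
        exact cfc_mono (fun t ht => hupp t (hspecB i hi ht)) (by fun_prop)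
          (hfB.add continuousOn_const)
    _ = C • (1 : 𝓐) + ∑ i ∈ s, p i • cfc f (B i) := by
        simp only [smul_add, Finset.sum_add_distrib, ← Finset.sum_smul, hp1, one_smul]
        rw [add_comm]

theorem stmt15 {H : Type*}
    [NormedAddCommGroup H] [InnerProductSpace ℂ H] [CompleteSpace H]
    (m M h : ℝ) (hm : 0 < m) (hmM : m < M) (hh : h = M / m)
    (n : ℕ) (A B : Fin n → H →L[ℂ] H)
    (hA : ∀ i, IsSelfAdjoint (A i)) (hB : ∀ i, IsSelfAdjoint (B i))
    (hApos : ∀ i, 0 ≤ A i) (hBpos : ∀ i, 0 ≤ B i)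
    (hAinv : ∀ i, IsUnit (A i)) (hBinv : ∀ i, IsUnit (B i))
    (hspecA : ∀ i, spectrum ℝ (A i) ⊆ Set.Icc m M)
    (hspecB : ∀ i, spectrum ℝ (B i) ⊆ Set.Icc m M)
    (p : Fin n → ℝ) (hp : ∀ i, 0 < p i) (hp1 : ∑ i, p i = 1)
    (heq : ∑ i, p i • A i = ∑ i, p i • B i)
    (r : ℝ) (hr : r < 0 ∨ 1 < r) :
    ∑ i, p i • cfc (fun t : ℝ => t ^ r) (A i) ≤
      (m ^ r * ((h - h ^ r) / (h - 1) +
          (r - 1) * ((h ^ r - 1) / (r * (h - 1))) ^ (r / (r - 1)))) • (1 : H →L[ℂ] H) +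
        ∑ i, p i • cfc (fun t : ℝ => t ^ r) (B i) := by
  obtain ⟨a, b, hab⟩ := exists_affine_rpow_bounds hm hmM hh hr
  have hcont : ContinuousOn (fun t : ℝ => t ^ r) (Set.Icc m M) := fun t ht =>
    (Real.continuousAt_rpow_const t r (Or.inl (hm.trans_le ht.1).ne')).continuousWithinAt
  exact sum_smul_cfc_le_of_affine_bounds Finset.univ (fun i _ => hA i) (fun i _ => hB i)
    (fun i _ => hspecA i) (fun i _ => hspecB i) (fun i _ => (hp i).le) hp1 heq hcont
    (fun t ht => (hab t ht).1) (fun t ht => (hab t ht).2)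
end

section
/- Let r > 0, 0 < ε < 1, and let p₁,…,pₙ and q₁,…,qₙ be probability distributions with pᵢ, qᵢ ∈ [ε,1] for all i and ∑pᵢ = ∑qᵢ = 1. If ∑_{i=1}^n pᵢ qᵢ ≤ ∑_{i=1}^n pᵢ², then ∑_{i=1}^n pᵢ ln_r(1/pᵢ) ≤ (ln_r(ε^{−1})/(1 − ε)) · ∑_{i=1}^n pᵢ ln_r(1/qᵢ), where ln_r t = (t^r − 1)/r. -/
/-- The `r`-logarithmic function `ln_r t = (t^r - 1)/r`. -/
noncomputable def lnr (r t : ℝ) : ℝ := (t ^ r - 1) / r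

theorem convexOn_rpow_of_nonpos {s : ℝ} (hs : s ≤ 0) :
    ConvexOn ℝ (Set.Ioi 0) fun x : ℝ => x ^ s := by
  refine ⟨convex_Ioi 0, fun x hx y hy a b ha hb hab => ?_⟩
  have hxy : 0 < a • x + b • y := convex_Ioi 0 hx hy ha hb hab
  have hlog := mul_le_mul_of_nonpos_right
    (strictConcaveOn_log_Ioi.concaveOn.2 hx hy ha hb hab) hs
  have hexp := convexOn_exp.2 (Set.mem_univ (Real.log x * s)) (Set.mem_univ (Real.log y * s))
    ha hb hab
  simp only [Real.rpow_def_of_pos hxy, Real.rpow_def_of_pos (Set.mem_Ioi.1 hx),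
    Real.rpow_def_of_pos (Set.mem_Ioi.1 hy)]
  refine (Real.exp_le_exp.2 (hlog.trans_eq ?_)).trans hexp
  simp only [smul_eq_mul]
  ring

theorem lnr_one_div {r t : ℝ} (ht : 0 < t) : lnr r (1 / t) = (t ^ (-r) - 1) / r := by
  rw [lnr, one_div, Real.inv_rpow ht.le, Real.rpow_neg ht.le]

theorem one_sub_le_lnr_one_div {r t : ℝ} (hr : 0 < r) (ht : 0 < t) :
    1 - t ≤ lnr r (1 / t) := by
  rw [lnr_one_div ht, le_div_iff₀ hr, Real.rpow_def_of_pos ht]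
  have hexp := Real.add_one_le_exp (Real.log t * -r)
  have hlog := mul_le_mul_of_nonneg_right (Real.log_le_sub_one_of_pos ht) hr.le
  linarith

/-- On `[ε, 1]`, the convex function `t ↦ ln_r (1 / t)` lies below its chord. -/
theorem lnr_one_div_le_chord {r ε t : ℝ} (hr : 0 < r) (hε0 : 0 < ε) (hε1 : ε < 1)
    (ht : t ∈ Set.Icc ε 1) : lnr r (1 / t) ≤ lnr r ε⁻¹ / (1 - ε) * (1 - t) := by
  have h1ε : 0 < 1 - ε := sub_pos.2 hε1
  have hconv := (convexOn_rpow_of_nonpos (neg_nonpos.2 hr.le)).2 (Set.mem_Ioi.2 hε0)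
    (Set.mem_Ioi.2 one_pos) (div_nonneg (sub_nonneg.2 ht.2) h1ε.le)
    (div_nonneg (sub_nonneg.2 ht.1) h1ε.le) (by field_simp; ring)
  have hcomb : (1 - t) / (1 - ε) * ε + (t - ε) / (1 - ε) * 1 = t := by
    field_simp
    ring
  simp only [smul_eq_mul, hcomb, Real.one_rpow] at hconv
  have hchord : ((1 - t) / (1 - ε) * ε ^ (-r) + (t - ε) / (1 - ε) * 1 - 1) / r =
      (ε ^ (-r) - 1) / r / (1 - ε) * (1 - t) := by
    field_simp
    ring
  rw [← one_div ε, lnr_one_div hε0, lnr_one_div (hε0.trans_le ht.1), ← hchord]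
  gcongr

theorem stmt18 (r : ℝ) (hr : 0 < r) (ε : ℝ) (hε0 : 0 < ε) (hε1 : ε < 1)
    (n : ℕ) (p q : Fin n → ℝ)
    (hp : ∀ i, p i ∈ Set.Icc ε 1) (hq : ∀ i, q i ∈ Set.Icc ε 1)
    (hp1 : ∑ i, p i = 1) (hq1 : ∑ i, q i = 1)
    (hqp : ∑ i, p i * q i ≤ ∑ i, p i ^ 2) :
    ∑ i, p i * lnr r (1 / p i) ≤
      (lnr r ε⁻¹ / (1 - ε)) * ∑ i, p i * lnr r (1 / q i) := by
  have hp0 (i) : 0 ≤ p i := hε0.le.trans (hp i).1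
  have hC : 0 ≤ lnr r ε⁻¹ / (1 - ε) := by
    have h := one_sub_le_lnr_one_div hr hε0
    rw [one_div] at h
    exact div_nonneg (by linarith) (by linarith)
  calc ∑ i, p i * lnr r (1 / p i)
      ≤ ∑ i, p i * (lnr r ε⁻¹ / (1 - ε) * (1 - p i)) := Finset.sum_le_sum fun i _ =>
        mul_le_mul_of_nonneg_left (lnr_one_div_le_chord hr hε0 hε1 (hp i)) (hp0 i)
    _ = lnr r ε⁻¹ / (1 - ε) * (∑ i, p i - ∑ i, p i ^ 2) := by
        rw [← Finset.sum_sub_distrib, Finset.mul_sum]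
        exact Finset.sum_congr rfl fun i _ => by ring
    _ ≤ lnr r ε⁻¹ / (1 - ε) * (∑ i, p i - ∑ i, p i * q i) := by gcongr
    _ = lnr r ε⁻¹ / (1 - ε) * ∑ i, p i * (1 - q i) := by
        simp only [mul_sub, mul_one, Finset.sum_sub_distrib]
    _ ≤ lnr r ε⁻¹ / (1 - ε) * ∑ i, p i * lnr r (1 / q i) :=
        mul_le_mul_of_nonneg_left (Finset.sum_le_sum fun i _ => mul_le_mul_of_nonneg_left
          (one_sub_le_lnr_one_div hr (hε0.trans_le (hq i).1)) (hp0 i)) hC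
end

section
/- Let r > 0, 0 < ε < 1, and let p₁,…,pₙ and q₁,…,qₙ be probability distributions with pᵢ, qᵢ ∈ [ε,1] for all i and ∑pᵢ = ∑qᵢ = 1. If ∑_{i=1}^n pᵢ qᵢ ≤ ∑_{i=1}^n pᵢ², then ∑_{i=1}^n pᵢ ln_r(1/pᵢ) ≤ ls_r(ε) + ∑_{i=1}^n pᵢ ln_r(1/qᵢ), where, writing c = ln_r(ε^{−1})/(1 − ε), the constant is ls_r(ε) = c − c^{r/(r+1)} − ln_r(c^{1/(r+1)}) and ln_r t = (t^r − 1)/r. -/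
/-- The constant `ls_r(ε) = c - c^{r/(r+1)} - ln_r (c^{1/(r+1)})`, where
`c = ln_r(ε⁻¹)/(1 - ε)`; a parametric extension of the logarithm of the Specht ratio. -/
noncomputable def lsr (r ε : ℝ) : ℝ :=
  lnr r ε⁻¹ / (1 - ε) - (lnr r ε⁻¹ / (1 - ε)) ^ (r / (r + 1)) -
    lnr r ((lnr r ε⁻¹ / (1 - ε)) ^ (1 / (r + 1)))

/-- The convex function `t ↦ ln_r (1/t)` lies above its tangent lines. -/
theorem lnr_one_div_tangent_le {r s t : ℝ} (hr : 0 < r) (hs : 0 < s) (ht : 0 < t) :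
    lnr r (1 / s) - s ^ (-(r + 1)) * (t - s) ≤ lnr r (1 / t) := by
  have hu : 0 < t / s := div_pos ht hs
  have bernoulli : 1 - r * (t / s - 1) ≤ (t / s) ^ (-r) := by
    rw [Real.rpow_def_of_pos hu]
    have h1 := Real.log_le_sub_one_of_pos hu
    have h2 := Real.add_one_le_exp (Real.log (t / s) * -r)
    nlinarith
  have hsr : 0 < s ^ (-r) := Real.rpow_pos_of_pos hs _
  rw [Real.div_rpow ht.le hs.le, le_div_iff₀ hsr] at bernoulli
  have hpow : s ^ (-(r + 1)) = s ^ (-r) / s := by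
    rw [neg_add', Real.rpow_sub hs, Real.rpow_one]
  have hinv : ∀ x : ℝ, 0 < x → (1 / x) ^ r = x ^ (-r) := fun x hx => by
    rw [one_div, Real.inv_rpow hx.le, Real.rpow_neg hx.le]
  unfold lnr
  rw [hpow, hinv s hs, hinv t ht, le_div_iff₀ hr]
  have heq : ((s ^ (-r) - 1) / r - s ^ (-r) / s * (t - s)) * r =
      (1 - r * (t / s - 1)) * s ^ (-r) - 1 := by
    field_simp
    ring
  linarith

theorem stmt19 (r : ℝ) (hr : 0 < r) (ε : ℝ) (hε0 : 0 < ε) (hε1 : ε < 1)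
    (n : ℕ) (p q : Fin n → ℝ)
    (hp : ∀ i, p i ∈ Set.Icc ε 1) (hq : ∀ i, q i ∈ Set.Icc ε 1)
    (hp1 : ∑ i, p i = 1) (hq1 : ∑ i, q i = 1)
    (hqp : ∑ i, p i * q i ≤ ∑ i, p i ^ 2) :
    ∑ i, p i * lnr r (1 / p i) ≤ lsr r ε + ∑ i, p i * lnr r (1 / q i) := by
  have hp0 : ∀ i, 0 ≤ p i := fun i => hε0.le.trans (hp i).1
  have hc : 0 < lnr r ε⁻¹ / (1 - ε) := by
    have : 1 < ε⁻¹ ^ r := Real.one_lt_rpow ((one_lt_inv₀ hε0).mpr hε1) hr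
    exact div_pos (div_pos (by linarith) hr) (by linarith)
  have chord : ∑ i, p i * lnr r (1 / p i) ≤
      ∑ i, p i * (lnr r ε⁻¹ / (1 - ε) * (1 - p i)) :=
    Finset.sum_le_sum fun i _ =>
      mul_le_mul_of_nonneg_left (lnr_one_div_le_chord hr hε0 hε1 (hp i)) (hp0 i)
  unfold lsr
  generalize lnr r ε⁻¹ / (1 - ε) = c at hc chord ⊢
  have hr1 : r + 1 ≠ 0 := by positivity
  obtain ⟨s, hs⟩ : ∃ s, s = c ^ (-(1 / (r + 1))) := ⟨_, rfl⟩
  have hs0 : 0 < s := hs ▸ Real.rpow_pos_of_pos hc _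
  have hslope : s ^ (-(r + 1)) = c := by
    rw [hs, ← Real.rpow_mul hc.le, neg_mul_neg, one_div_mul_cancel hr1, Real.rpow_one]
  have hinv : c ^ (1 / (r + 1)) = 1 / s := by
    rw [hs, Real.rpow_neg hc.le, one_div (_⁻¹), inv_inv]
  have hmul : c ^ (r / (r + 1)) = c * s := by
    rw [hs, ← Real.rpow_one_add' hc.le]
    · congr 1
      field_simp
      ring
    · have : 1 + -(1 / (r + 1)) = r / (r + 1) := by
        field_simp
        ring
      rw [this]
      positivity
  have tangent : ∑ i, p i * (lnr r (1 / s) - c * (q i - s)) ≤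
      ∑ i, p i * lnr r (1 / q i) :=
    Finset.sum_le_sum fun i _ => mul_le_mul_of_nonneg_left
      (hslope ▸ lnr_one_div_tangent_le hr hs0 (hε0.trans_le (hq i).1)) (hp0 i)
  have chord_sum : ∑ i, p i * (c * (1 - p i)) = c - c * ∑ i, p i ^ 2 := by
    calc _ = ∑ i, (c * p i - c * p i ^ 2) := Finset.sum_congr rfl fun i _ => by ring
      _ = _ := by rw [Finset.sum_sub_distrib, ← Finset.mul_sum, ← Finset.mul_sum, hp1, mul_one]
  have tangent_sum : ∑ i, p i * (lnr r (1 / s) - c * (q i - s)) =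
      lnr r (1 / s) + c * s - c * ∑ i, p i * q i := by
    calc _ = ∑ i, ((lnr r (1 / s) + c * s) * p i - c * (p i * q i)) :=
          Finset.sum_congr rfl fun i _ => by ring
      _ = _ := by rw [Finset.sum_sub_distrib, ← Finset.mul_sum, ← Finset.mul_sum, hp1, mul_one]
  rw [hinv, hmul]
  have := mul_le_mul_of_nonneg_left hqp hc.le
  linarith
end
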